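/- There do not exist a positive integer a, a positive integer d, and a squarefree positive integer R such that R divides each of a, a + d, a + 2d, a + 3d and each of the quotients a/R, (a + d)/R, (a + 2d)/R, (a + 3d)/R is the square of an integer. -/

import Mathlib

lemma aux_step {α β γ δ : ℤ} (ha : 0 < α) (hb : 0 < β) (hc : 0 < γ) (hd : 0 < δ)
    (h1 : IsCoprime α δ) (h2 : IsCoprime β γ) (hodd : Odd (γ * δ))
    (h : α ^ 2 * (4 * β ^ 2 - γ ^ 2) = δ ^ 2 * (γ ^ 2 - β ^ 2)) :
    δ ^ 2 + α ^ 2 = β ^ 2 ∧ δ ^ 2 + 4 * α ^ 2 = γ ^ 2 := by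
  have hcop : IsCoprime (δ ^ 2) (α ^ 2) := (h1.symm).pow
  obtain ⟨k, hk⟩ : δ ^ 2 ∣ 4 * β ^ 2 - γ ^ 2 :=
    hcop.dvd_of_dvd_mul_left ⟨_, h⟩
  have hk2 : γ ^ 2 - β ^ 2 = k * α ^ 2 := by
    have : δ ^ 2 ≠ 0 := by positivity
    apply mul_left_cancel₀ this
    rw [← h, hk]; ring
  have hk3 : k ∣ 3 := by
    have d1 : k ∣ 3 * β ^ 2 := ⟨δ ^ 2 + α ^ 2, by linear_combination hk + hk2⟩
    have d2 : k ∣ 3 * γ ^ 2 := ⟨δ ^ 2 + 4 * α ^ 2, by linear_combination hk + 4 * hk2⟩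
    obtain ⟨u, v, huv⟩ : IsCoprime (β ^ 2) (γ ^ 2) := h2.pow
    have : (3 : ℤ) = u * (3 * β ^ 2) + v * (3 * γ ^ 2) := by linear_combination -3 * huv
    rw [this]
    exact dvd_add (d1.mul_left _) (d2.mul_left _)
  have hpa : 0 < α ^ 2 := by positivity
  have hpb : 0 < β ^ 2 := by positivity
  have hpd : 0 < δ ^ 2 := by positivity
  have hkpos : 0 < k := by
    by_contra hneg
    push Not at hneg
    nlinarith
  have hkle : k ≤ 3 := Int.le_of_dvd (by norm_num) hk3
  obtain ⟨hco, hdo⟩ := Int.odd_mul.mp hodd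
  interval_cases k
  · exfalso
    obtain ⟨s, rfl⟩ := hco
    obtain ⟨t, rfl⟩ := hdo
    ring_nf at hk
    omega
  · omega
  · constructor <;> linarith

lemma aux_four {p q m n : ℤ} (hp : 0 < p) (hq : 0 < q) (hm : 0 < m) (hn : 0 < n)
    (h : p * q = m * n) : ∃ α β γ δ : ℤ, 0 < α ∧ 0 < β ∧ 0 < γ ∧ 0 < δ ∧
      p = α * β ∧ q = γ * δ ∧ m = α * γ ∧ n = β * δ := by
  have hg : 0 < (Int.gcd p m : ℤ) := by
    exact_mod_cast Int.gcd_pos_of_ne_zero_left _ hp.ne'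
  obtain ⟨β, hβ⟩ := Int.gcd_dvd_left p m
  obtain ⟨γ, hγ⟩ := Int.gcd_dvd_right p m
  have hcop : IsCoprime β γ := by
    rw [Int.isCoprime_iff_gcd_eq_one]
    have := Int.gcd_mul_left (Int.gcd p m : ℤ) β γ
    rw [← hβ, ← hγ] at this
    have h0 : Int.gcd p m ≠ 0 := by exact_mod_cast hg.ne'
    simp only [Int.natAbs_natCast] at this
    exact (Nat.eq_of_mul_eq_mul_left (Nat.pos_of_ne_zero h0) (by omega)).symm
  generalize (Int.gcd p m : ℤ) = g at *
  have hβ0 : 0 < β := by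
    rw [hβ] at hp; exact pos_of_mul_pos_right hp hg.le
  have hγ0 : 0 < γ := by
    rw [hγ] at hm; exact pos_of_mul_pos_right hm hg.le
  have e : β * q = γ * n := by
    apply mul_left_cancel₀ hg.ne'
    rw [hβ, hγ] at h
    linear_combination h
  obtain ⟨δ, hδ⟩ : β ∣ n := hcop.dvd_of_dvd_mul_left ⟨q, e.symm⟩
  refine ⟨g, β, γ, δ, hg, hβ0, hγ0, ?_, hβ, ?_, hγ, hδ⟩
  · rw [hδ] at hn; exact pos_of_mul_pos_right hn hβ0.le
  · apply mul_left_cancel₀ hβ0.ne'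
    rw [e, hδ]; ring

lemma aux_param {x y z : ℤ} (hy : 0 < y) (hz : 0 < z) (hx : x % 2 = 1)
    (hc : IsCoprime x y) (h : x ^ 2 + y ^ 2 = z ^ 2) :
    ∃ m n : ℤ, 0 < m ∧ 0 < n ∧ x = m ^ 2 - n ^ 2 ∧ y = 2 * m * n ∧ IsCoprime m n ∧
      (m % 2 = 0 ∧ n % 2 = 1 ∨ m % 2 = 1 ∧ n % 2 = 0) := by
  have ht : PythagoreanTriple x y z := by
    unfold PythagoreanTriple; linarith
  obtain ⟨m, n, h1, h2, h3, h4, h5, h6⟩ :=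
    ht.coprime_classification' (Int.isCoprime_iff_gcd_eq_one.mp hc) hx hz
  have hm : 0 < m := by
    rcases h6.lt_or_eq with h | h
    · exact h
    · subst h; simp at h2; omega
  refine ⟨m, n, hm, ?_, h1, h2, Int.isCoprime_iff_gcd_eq_one.mpr h4, h5⟩
  rw [h2] at hy
  exact pos_of_mul_pos_right hy (by omega)

lemma aux_descent (N : ℕ) : ∀ x y z w : ℤ, 0 < x → 0 < y → 0 < z → 0 < w → x * y < N →
    x ^ 2 + y ^ 2 = z ^ 2 → x ^ 2 + 4 * y ^ 2 = w ^ 2 → False := by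
  induction N with
  | zero =>
    intro x y z w hx hy _ _ hlt
    have := mul_pos hx hy
    push_cast at hlt
    omega
  | succ N ih =>
    intro x y z w hx hy hz hw hlt h1 h2
    push_cast at hlt
    by_cases hg : IsCoprime x y
    swap
    · rw [Int.isCoprime_iff_gcd_eq_one] at hg
      have hg0 : 0 < Int.gcd x y := Int.gcd_pos_of_ne_zero_left _ hx.ne'
      have hg2 : (2 : ℤ) ≤ (Int.gcd x y : ℤ) := by omega
      obtain ⟨a, ha⟩ := Int.gcd_dvd_left x y
      obtain ⟨b, hb⟩ := Int.gcd_dvd_right x y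
      generalize (Int.gcd x y : ℤ) = g at *
      have hgp : 0 < g := by omega
      obtain ⟨c, hc⟩ : g ∣ z := by
        rw [← Int.pow_dvd_pow_iff two_ne_zero, ← h1, ha, hb]
        exact ⟨a ^ 2 + b ^ 2, by ring⟩
      obtain ⟨e, he⟩ : g ∣ w := by
        rw [← Int.pow_dvd_pow_iff two_ne_zero, ← h2, ha, hb]
        exact ⟨a ^ 2 + 4 * b ^ 2, by ring⟩
      subst ha hb hc he
      have ha := pos_of_mul_pos_right hx hgp.le
      have hb := pos_of_mul_pos_right hy hgp.le
      have hab := mul_pos ha hb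
      have hgg : g ^ 2 ≠ 0 := by positivity
      refine ih a b c e ha hb (pos_of_mul_pos_right hz hgp.le)
        (pos_of_mul_pos_right hw hgp.le) ?_ ?_ ?_
      · have : g * a * (g * b) = g ^ 2 * (a * b) := by ring
        have hg4 : 4 ≤ g ^ 2 := by nlinarith
        have := mul_le_mul_of_nonneg_right hg4 hab.le
        linarith
      · apply mul_left_cancel₀ hgg; linear_combination h1
      · apply mul_left_cancel₀ hgg; linear_combination h2
    rcases Int.emod_two_eq_zero_or_one x with hx2 | hx2
    · obtain ⟨t, rfl⟩ : (2 : ℤ) ∣ x := Int.dvd_of_emod_eq_zero hx2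
      obtain ⟨s, rfl⟩ : (2 : ℤ) ∣ w := by
        have : (2 : ℤ) ∣ w ^ 2 := ⟨2 * t ^ 2 + 2 * y ^ 2, by linear_combination -h2⟩
        exact Int.prime_two.dvd_of_dvd_pow this
      have ht : 0 < t := by omega
      refine ih y t s z hy ht (by omega) hz ?_ ?_ ?_
      · have := mul_pos hy ht
        nlinarith
      · linarith
      · linarith
    · have hyev : y % 2 = 0 := by
        rcases Int.emod_two_eq_zero_or_one y with h | h
        · exact h
        · exfalso
          have a1 : x ^ 2 % 4 = 1 := by
            rcases (by omega : x % 4 = 1 ∨ x % 4 = 3) with h | h <;> simp [pow_two, Int.mul_emod, h]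
          have a2 : y ^ 2 % 4 = 1 := by
            rcases (by omega : y % 4 = 1 ∨ y % 4 = 3) with h | h <;> simp [pow_two, Int.mul_emod, h]
          have := Int.sq_ne_two_mod_four z
          rw [← pow_two] at this
          omega
      have hx2c : IsCoprime x (2 * y) := by
        refine IsCoprime.mul_right ⟨1, -(x / 2), ?_⟩ hg
        omega
      obtain ⟨m, n, hm, hn, e1, e2, hmn, -⟩ := aux_param hy hz hx2 hg h1
      obtain ⟨M, K, hM, hK, e3, e4, hMK, hpar⟩ :=
        aux_param (by omega : 0 < 2 * y) hw hx2 hx2c (by linarith)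
      have e5 : y = M * K := by linarith
      have key : ∀ α β γ δ : ℤ, 0 < α → 0 < β → 0 < γ → 0 < δ → IsCoprime α δ →
          IsCoprime β γ → Odd (γ * δ) → y = 2 * (α * β) * (γ * δ) →
          α ^ 2 * (4 * β ^ 2 - γ ^ 2) = δ ^ 2 * (γ ^ 2 - β ^ 2) → False := by
        intro α β γ δ ha hb hc hd c1 c2 ho hyy he
        obtain ⟨f1, f2⟩ := aux_step ha hb hc hd c1 c2 ho he
        refine ih δ α β γ hd ha hb hc ?_ f1 f2
        have p1 : 0 < δ * α := mul_pos hd ha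
        have p2 : 0 < β * γ := mul_pos hb hc
        have p3 : y = 2 * ((δ * α) * (β * γ)) := by rw [hyy]; ring
        nlinarith
      rcases hpar with ⟨k1, k2⟩ | ⟨k1, k2⟩
      · obtain ⟨P, rfl⟩ : (2 : ℤ) ∣ M := Int.dvd_of_emod_eq_zero k1
        obtain ⟨α, β, γ, δ, ha, hb, hc, hd, q1, q2, q3, q4⟩ :=
          aux_four (by omega : 0 < P) hK hm hn (by linarith)
        subst q1 q2 q3 q4
        refine key α β γ δ ha hb hc hd ?_ ?_ (Int.odd_iff.mpr k2) e5 ?_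
        · exact hmn.of_mul_left_left.of_mul_right_right
        · exact hmn.symm.of_mul_left_left.of_mul_right_right
        · linear_combination e1 - e3
      · obtain ⟨P, rfl⟩ : (2 : ℤ) ∣ K := Int.dvd_of_emod_eq_zero k2
        obtain ⟨α, β, γ, δ, ha, hb, hc, hd, q1, q2, q3, q4⟩ :=
          aux_four (by omega : 0 < P) hM hn hm (by linarith)
        subst q1 q2 q3 q4
        refine key α β γ δ ha hb hc hd ?_ ?_ (Int.odd_iff.mpr k1) (by rw [e5]; ring) ?_
        · exact hmn.symm.of_mul_left_left.of_mul_right_right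
        · exact hmn.of_mul_left_left.of_mul_right_right
        · linear_combination e3 - e1

lemma aux_ap {a b c e D : ℤ} (ha : 0 ≤ a) (hb : 0 ≤ b) (hc : 0 ≤ c) (he : 0 ≤ e)
    (hD : 0 < D) (h1 : b ^ 2 = a ^ 2 + D) (h2 : c ^ 2 = a ^ 2 + 2 * D)
    (h3 : e ^ 2 = a ^ 2 + 3 * D) : False := by
  have hab : a < b := by nlinarith
  have hbc : b < c := by nlinarith
  have hce : c < e := by nlinarith
  have hlt : a * e < b * c := by
    have : (a * e) ^ 2 < (b * c) ^ 2 := by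
      have : (b * c) ^ 2 = (a * e) ^ 2 + 2 * D ^ 2 := by
        rw [mul_pow, mul_pow, h1, h2, h3]; ring
      have : 0 < D ^ 2 := by positivity
      linarith
    exact lt_of_pow_lt_pow_left₀ 2 (by positivity) this
  refine aux_descent (((b * c - a * e) * D).toNat + 1) (b * c - a * e) D (b * e - a * c)
    (c * e - a * b) (by linarith) hD (by nlinarith) (by nlinarith) ?_ ?_ ?_
  · push_cast
    have := Int.self_le_toNat ((b * c - a * e) * D)
    omega
  · have : (b * c) ^ 2 + (a * e) ^ 2 + D ^ 2 = (b * e) ^ 2 + (a * c) ^ 2 := by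
      simp only [mul_pow, h1, h2, h3]; ring
    linear_combination this
  · have : (b * c) ^ 2 + (a * e) ^ 2 + 4 * D ^ 2 = (c * e) ^ 2 + (a * b) ^ 2 := by
      simp only [mul_pow, h1, h2, h3]; ring
    linear_combination this

theorem no_common_squarefree_part :
    ¬ ∃ (a d R : ℕ), 0 < a ∧ 0 < d ∧ 0 < R ∧ Squarefree R ∧
      (∀ j : ℕ, j < 4 → R ∣ (a + j * d) ∧ ∃ m : ℕ, (a + j * d) / R = m ^ 2) := by
  rintro ⟨a, d, R, -, hd, hR, -, h⟩
  obtain ⟨d0, m0, h0⟩ := h 0 (by norm_num)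
  obtain ⟨d1, m1, h1⟩ := h 1 (by norm_num)
  obtain ⟨d2, m2, h2⟩ := h 2 (by norm_num)
  obtain ⟨d3, m3, h3⟩ := h 3 (by norm_num)
  rw [zero_mul, add_zero] at d0 h0
  rw [one_mul] at d1 h1
  obtain ⟨D, rfl⟩ : R ∣ d := (Nat.dvd_add_right d0).mp d1
  obtain ⟨A, rfl⟩ := d0
  have hD : 0 < D := Nat.pos_of_mul_pos_left hd
  rw [Nat.mul_div_cancel_left _ hR] at h0
  rw [show R * A + R * D = R * (A + D) by ring, Nat.mul_div_cancel_left _ hR] at h1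
  rw [show R * A + 2 * (R * D) = R * (A + 2 * D) by ring, Nat.mul_div_cancel_left _ hR] at h2
  rw [show R * A + 3 * (R * D) = R * (A + 3 * D) by ring, Nat.mul_div_cancel_left _ hR] at h3
  subst h0
  exact aux_ap (a := m0) (b := m1) (c := m2) (e := m3) (D := D) (by positivity) (by positivity)
    (by positivity) (by positivity) (by exact_mod_cast hD) (by exact_mod_cast h1.symm)
    (by exact_mod_cast h2.symm) (by exact_mod_cast h3.symm)
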